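/- The martingale selection problem (V,C) is solvable if and only if W_t(ω) ≠ ∅ for every t ∈ I and every ω ∈ Ω. -/

import Mathlib

open Set MeasureTheory Pointwise

namespace MSPPaper

section Defs

variable {Ω E : Type*}

/-- A finitely supported probability measure on `Ω`: finite support, strictly
positive weights on the support, total mass one. -/
structure FinProb (Ω : Type*) where
  supp : Finset Ω
  w : Ω → ℝ
  pos : ∀ ω ∈ supp, 0 < w ω
  zero : ∀ ω ∉ supp, w ω = 0
  sum_one : ∑ ω ∈ supp, w ω = 1

/-- The measure of a set under a finitely supported probability. -/
noncomputable def FinProb.meas (Q : FinProb Ω) (A : Set Ω) : ℝ :=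
  letI := Classical.decPred fun ω => ω ∈ A
  ∑ ω ∈ Q.supp.filter (fun ω => ω ∈ A), Q.w ω

/-- The level set `Σ_t^ω` of the process `ψ`. -/
def level (ψ : ℕ → Ω → E) (t : ℕ) (ω : Ω) : Set Ω :=
  {ω' | ∀ s ≤ t, ψ s ω' = ψ s ω}

/-- The conditional expectation `E_Q[ξ | F_t](ω)`. -/
noncomputable def condExp {F : Type*} [AddCommMonoid F] [Module ℝ F]
    (ψ : ℕ → Ω → E) (t : ℕ) (Q : FinProb Ω) (ξ : Ω → F) (ω : Ω) : F :=
  letI := Classical.decPred fun ω' => ω' ∈ level ψ t ω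
  (Q.meas (level ψ t ω))⁻¹ •
    ∑ ω' ∈ Q.supp.filter (fun ω' => ω' ∈ level ψ t ω), Q.w ω' • ξ ω'

variable [MeasurableSpace E]

/-- The natural filtration `F̂_t` generated by `ψ_0, …, ψ_t`. -/
def natFilt (ψ : ℕ → Ω → E) (t : ℕ) : MeasurableSpace Ω :=
  ⨆ s ∈ Finset.range (t + 1), MeasurableSpace.comap (ψ s) inferInstance

/-- The `P`-null sets relative to `F̂_t`. -/
def nullSets (ψ : ℕ → Ω → E) (P : FinProb Ω) (t : ℕ) : Set (Set Ω) :=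
  {A | ∃ A', A ⊆ A' ∧ MeasurableSet[natFilt ψ t] A' ∧ P.meas A' = 0}

/-- The completed filtration `F_t`. -/
def filt (ψ : ℕ → Ω → E) (t : ℕ) : MeasurableSpace Ω :=
  ⨅ P : FinProb Ω,
    MeasurableSpace.generateFrom ({A | MeasurableSet[natFilt ψ t] A} ∪ nullSets ψ P t)

/-- `G`-measurability of a correspondence. -/
def CorrMeasurable {F : Type*} [TopologicalSpace F]
    (G : MeasurableSpace Ω) (U : Ω → Set F) : Prop :=
  ∀ O : Set F, IsOpen O → MeasurableSet[G] {ω | (U ω ∩ O).Nonempty}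

/-- The set `L(G; U)` of `G`-measurable selections of `U`. -/
def Selections {F : Type*} [MeasurableSpace F]
    (G : MeasurableSpace Ω) (U : Ω → Set F) : Set (Ω → F) :=
  {ξ | Measurable[G] ξ ∧ ∀ ω, ξ ω ∈ U ω}

/-- The correspondence `U^♯` (taken at stage `t`). -/
def sharp {d : ℕ} (ψ : ℕ → Ω → E) (t : ℕ) (U : Ω → Set (Fin d → ℝ)) (ω : Ω) :
    Set (Fin d → ℝ) :=
  convexHull ℝ (⋃ ω' ∈ level ψ t ω, U ω')

/-- The correspondence `U^♭` (taken at stage `t`). -/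
def flat {d : ℕ} (ψ : ℕ → Ω → E) (t : ℕ) (U : Ω → Set (Fin d → ℝ)) (ω : Ω) :
    Set (Fin d → ℝ) :=
  ⋂ ω' ∈ level ψ t ω, ⋃ l ∈ Ioo (0 : ℝ) 1, (l • U ω' + (1 - l) • sharp ψ t U ω)

/-- The backward iteration defining `W`, indexed from the terminal date. -/
def Wrev {d : ℕ} (ψ : ℕ → Ω → E) (T : ℕ) (V C : ℕ → Ω → Set (Fin d → ℝ)) :
    ℕ → Ω → Set (Fin d → ℝ)
  | 0 => V T
  | (k + 1) => fun ω =>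
      V (T - (k + 1)) ω ∩
        (flat ψ (T - (k + 1)) (Wrev ψ T V C k) ω - C (T - (k + 1)) ω)

/-- The sequence `W_t`: `W_T = V_T` and `W_t = V_t ∩ (W_{t+1}^♭ − C_t)` for `t < T`. -/
def W {d : ℕ} (ψ : ℕ → Ω → E) (T : ℕ) (V C : ℕ → Ω → Set (Fin d → ℝ)) (t : ℕ) :
    Ω → Set (Fin d → ℝ) :=
  Wrev ψ T V C (T - t)

/-- The defining hypotheses of a martingale selection problem `(V, C)`:
adapted measurable correspondences, `V_t(ω)` convex and relatively open,
`C_t(ω)` closed and convex. -/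
def IsMSP {d : ℕ} (ψ : ℕ → Ω → E) (T : ℕ) (V C : ℕ → Ω → Set (Fin d → ℝ)) : Prop :=
  ∀ t ≤ T,
    CorrMeasurable (filt ψ t) (V t) ∧ CorrMeasurable (filt ψ t) (C t) ∧
    ∀ ω : Ω, Convex ℝ (V t ω) ∧ V t ω = intrinsicInterior ℝ (V t ω) ∧
      IsClosed (C t ω) ∧ Convex ℝ (C t ω)

/-- `(ξ, Q)` is a solution of the martingale selection problem `(V, C)`. -/
def IsSolution {d : ℕ} (ψ : ℕ → Ω → E) (T : ℕ) (V C : ℕ → Ω → Set (Fin d → ℝ))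
    (ξ : ℕ → Ω → (Fin d → ℝ)) (Q : FinProb Ω) : Prop :=
  (∀ t ≤ T, ξ t ∈ Selections (filt ψ t) (V t)) ∧
  (∀ t, t + 1 ≤ T → ∀ ω ∈ Q.supp, condExp ψ t Q (ξ (t + 1)) ω - ξ t ω ∈ C t ω)

/-- Solvability of the martingale selection problem: a local solution exists at
every point of `Ω`. -/
def Solvable {d : ℕ} (ψ : ℕ → Ω → E) (T : ℕ) (V C : ℕ → Ω → Set (Fin d → ℝ)) : Prop :=
  ∀ ωb : Ω, ∃ (ξ : ℕ → Ω → (Fin d → ℝ)) (Q : FinProb Ω),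
    ωb ∈ Q.supp ∧ IsSolution ψ T V C ξ Q

/-- The positive polar cone of a subset of `ℝ^d`. -/
def polar {d : ℕ} (B : Set (Fin d → ℝ)) : Set (Fin d → ℝ) :=
  {y | ∀ x ∈ B, 0 ≤ ∑ i, y i * x i}

/-- A closed convex cone (containing the origin). -/
def IsClosedConvexCone {F : Type*} [TopologicalSpace F] [AddCommMonoid F] [Module ℝ F]
    (A : Set F) : Prop :=
  IsClosed A ∧ Convex ℝ A ∧ (0 : F) ∈ A ∧ ∀ c : ℝ, 0 < c → ∀ x ∈ A, c • x ∈ A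

end Defs

section ConvexGeometry

variable {F : Type*} [NormedAddCommGroup F] [NormedSpace ℝ F]

/-- The points lying strictly between a point of `U` and a point of `S`. -/
def mix {F : Type*} [AddCommGroup F] [Module ℝ F] (U S : Set F) : Set F :=
  {y | ∃ u ∈ U, ∃ s ∈ S, y ∈ openSegment ℝ u s}

lemma mix_mono {U U' S S' : Set F} (hU : U ⊆ U') (hS : S ⊆ S') : mix U S ⊆ mix U' S' := by
  rintro y ⟨u, hu, s, hs, h⟩
  exact ⟨u, hU hu, s, hS hs, h⟩

lemma mix_subset {U S : Set F} (hS : Convex ℝ S) (hU : U ⊆ S) : mix U S ⊆ S := by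
  rintro y ⟨u, hu, s, hs, h⟩
  exact hS.openSegment_subset (hU hu) hs h

lemma mem_mix_iff {U S : Set F} {y : F} :
    y ∈ mix U S ↔ ∃ l ∈ Ioo (0 : ℝ) 1, y ∈ l • U + (1 - l) • S := by
  constructor
  · rintro ⟨u, hu, s, hs, a, b, ha, hb, hab, rfl⟩
    refine ⟨a, ⟨ha, by linarith⟩, ?_⟩
    obtain rfl : b = 1 - a := by linarith
    exact add_mem_add (smul_mem_smul_set hu) (smul_mem_smul_set hs)
  · rintro ⟨l, ⟨h0, h1⟩, h⟩
    obtain ⟨_, ⟨u, hu, rfl⟩, _, ⟨s, hs, rfl⟩, rfl⟩ := h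
    exact ⟨u, hu, s, hs, l, 1 - l, h0, by linarith, by ring, rfl⟩

/-- If `y` lies strictly between `x` and `c`, and `x` strictly between `u` and `v`, then `y` lies
strictly between `u` and a point of any convex set containing `v` and `c`. -/
lemma exists_mem_openSegment_of_openSegment {S : Set F} (hS : Convex ℝ S) {x y u v c : F}
    (hv : v ∈ S) (hc : c ∈ S) (hx : x ∈ openSegment ℝ u v) (hy : y ∈ openSegment ℝ x c) :
    ∃ s ∈ S, y ∈ openSegment ℝ u s := by
  obtain ⟨m, n, hm, hn, hmn, rfl⟩ := hx
  obtain ⟨a, b, ha, hb, hab, rfl⟩ := hy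
  have hp : 0 < a * n + b := by positivity
  refine ⟨(a * n / (a * n + b)) • v + (b / (a * n + b)) • c,
    hS hv hc (by positivity) (by positivity) (by field_simp),
    a * m, a * n + b, by positivity, hp, by rw [← add_assoc, ← mul_add, hmn, mul_one, hab], ?_⟩
  have e1 : (a * n + b) * (a * n / (a * n + b)) = a * n := by field_simp
  have e2 : (a * n + b) * (b / (a * n + b)) = b := by field_simp
  rw [smul_add, smul_smul, smul_smul, e1, e2, smul_add, smul_smul, smul_smul, add_assoc]

lemma mem_mix_of_mem_openSegment {U S : Set F} (hS : Convex ℝ S) {y s z : F}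
    (hy : y ∈ mix U S) (hs : s ∈ S) (hz : z ∈ openSegment ℝ y s) : z ∈ mix U S := by
  obtain ⟨u, hu, v, hv, h⟩ := hy
  obtain ⟨c, hc, h'⟩ := exists_mem_openSegment_of_openSegment hS hv hs h hz
  exact ⟨u, hu, c, hc, h'⟩

lemma exists_ball_of_mem_intrinsicInterior {s : Set F} {x : F}
    (hx : x ∈ intrinsicInterior ℝ s) :
    ∃ δ > 0, ∀ x' ∈ affineSpan ℝ s, dist x' x < δ → x' ∈ s := by
  obtain ⟨⟨x, hxs⟩, hi, rfl⟩ := mem_intrinsicInterior.1 hx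
  rw [mem_interior_iff_mem_nhds, Metric.mem_nhds_iff] at hi
  obtain ⟨δ, hδ, h⟩ := hi
  exact ⟨δ, hδ, fun x' hx' hd => h (show (⟨x', hx'⟩ : affineSpan ℝ s) ∈ Metric.ball _ δ from hd)⟩

/-- A point of the relative interior can be pushed slightly away from any point of the affine
span. -/
lemma exists_dist_lt_mem_openSegment (s : Set F) {x b : F} (hx : x ∈ affineSpan ℝ s)
    (hb : b ∈ affineSpan ℝ s) {δ : ℝ} (hδ : 0 < δ) :
    ∃ c ∈ affineSpan ℝ s, dist c x < δ ∧ x ∈ openSegment ℝ b c := by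
  have hcont : Continuous fun e : ℝ => AffineMap.lineMap b x (1 + e) := by
    exact (AffineMap.lineMap_continuous (R := ℝ) (p := b) (q := x)).comp (by fun_prop)
  have ht := hcont.tendsto 0
  simp only [add_zero, AffineMap.lineMap_apply_one] at ht
  have hev : ∀ᶠ e in nhdsWithin (0 : ℝ) (Ioi 0), dist (AffineMap.lineMap b x (1 + e)) x < δ :=
    (ht.mono_left nhdsWithin_le_nhds).eventually (Metric.ball_mem_nhds x hδ)
  obtain ⟨e, he, hpos⟩ := (hev.and self_mem_nhdsWithin).exists
  have hpos : 0 < e := hpos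
  refine ⟨_, AffineMap.lineMap_mem _ hb hx, he, e / (1 + e), 1 / (1 + e), by positivity,
    by positivity, by field_simp; ring, ?_⟩
  have e1 : 1 / (1 + e) * (1 + e) = 1 := by field_simp
  have e2 : 1 / (1 + e) * (1 - (1 + e)) = - (e / (1 + e)) := by field_simp; ring
  rw [AffineMap.lineMap_apply_module, smul_add, smul_smul, smul_smul, e1, e2]
  module

lemma mem_of_mem_openSegment_closure [FiniteDimensional ℝ F] {s : Set F}
    (hs : Convex ℝ s) {x z y : F}
    {δ : ℝ} (hδ : 0 < δ) (hx : x ∈ affineSpan ℝ s)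
    (hball : ∀ x' ∈ affineSpan ℝ s, dist x' x < δ → x' ∈ s)
    (hz : z ∈ closure s) (hy : y ∈ openSegment ℝ x z) : y ∈ s := by
  obtain ⟨a, b, ha, hb, hab, rfl⟩ := hy
  obtain ⟨z', hz', hd⟩ := Metric.mem_closure_iff.1 hz (δ * a / b) (by positivity)
  have hza : z ∈ affineSpan ℝ s :=
    closure_minimal (subset_affineSpan ℝ s)
      (AffineSubspace.closed_of_finiteDimensional _) hz
  have hx' : x + (b / a) • (z - z') ∈ s := by
    apply hball
    · have h1 := AffineSubspace.vsub_mem_direction hza (subset_affineSpan ℝ s hz')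
      have := AffineSubspace.vadd_mem_of_mem_direction
        ((affineSpan ℝ s).direction.smul_mem (b / a) h1) hx
      rwa [vadd_eq_add, vsub_eq_sub, add_comm] at this
    · rw [dist_eq_norm, add_sub_cancel_left, norm_smul, Real.norm_of_nonneg (by positivity),
        ← dist_eq_norm]
      calc b / a * dist z z' < b / a * (δ * a / b) := by gcongr
        _ = δ := by field_simp
  have := hs hx' hz' ha.le hb.le hab
  convert this using 1
  rw [smul_add, smul_smul, mul_div_cancel₀ _ ha.ne']
  module

/-- A nonempty convex set contains a point that is strictly between any of its points and
another of its points. -/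
lemma exists_forall_mem_openSegment [FiniteDimensional ℝ F] {A : Set F}
    (hA : Convex ℝ A) (hne : A.Nonempty) :
    ∃ a ∈ A, ∀ b ∈ A, ∃ c ∈ A, a ∈ openSegment ℝ b c := by
  obtain ⟨a, ha⟩ := hne.intrinsicInterior hA
  obtain ⟨δ, hδ, h⟩ := exists_ball_of_mem_intrinsicInterior ha
  have haA := intrinsicInterior_subset ha
  refine ⟨a, haA, fun b hb => ?_⟩
  obtain ⟨c, hc, hd, hac⟩ := exists_dist_lt_mem_openSegment A (subset_affineSpan ℝ A haA)
    (subset_affineSpan ℝ A hb) hδ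
  exact ⟨c, h c hc hd, hac⟩

lemma exists_forall_mem_closure_openSegment [FiniteDimensional ℝ F] {B : Set F}
    (hB : Convex ℝ B) (hne : B.Nonempty) :
    ∃ b₀ ∈ B, ∀ z ∈ closure B, ∀ y ∈ openSegment ℝ b₀ z, ∀ b ∈ B,
      ∃ c ∈ B, y ∈ openSegment ℝ b c := by
  obtain ⟨x, hx⟩ := hne.intrinsicInterior hB
  obtain ⟨δ, hδ, h⟩ := exists_ball_of_mem_intrinsicInterior hx
  have hxB := intrinsicInterior_subset hx
  refine ⟨x, hxB, fun z hz y hy b hb => ?_⟩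
  obtain ⟨c, hc, hd, hxc⟩ := exists_dist_lt_mem_openSegment B (subset_affineSpan ℝ B hxB)
    (subset_affineSpan ℝ B hb) (half_pos hδ)
  have hcball : ∀ x' ∈ affineSpan ℝ B, dist x' c < δ / 2 → x' ∈ B := fun x' hx' hd' =>
    h x' hx' (by linarith [dist_triangle x' c x])
  obtain ⟨m, n, hm, hn, hmn, rfl⟩ := hxc
  obtain ⟨p, q, hp, hq, hpq, rfl⟩ := hy
  have hr : 0 < p * n + q := by positivity
  refine ⟨(p * n / (p * n + q)) • c + (q / (p * n + q)) • z,
    mem_of_mem_openSegment_closure hB (half_pos hδ) hc hcball hz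
      ⟨_, _, by positivity, by positivity, by field_simp, rfl⟩,
    p * m, p * n + q, by positivity, hr, by rw [← add_assoc, ← mul_add, hmn, mul_one, hpq], ?_⟩
  have e1 : (p * n + q) * (p * n / (p * n + q)) = p * n := by field_simp
  have e2 : (p * n + q) * (q / (p * n + q)) = q := by field_simp
  rw [smul_add, smul_smul, smul_smul, e1, e2, smul_add, smul_smul, smul_smul, add_assoc]

/-- A relatively open convex set is contained in every relatively open convex set with the
same closure. -/
lemma subset_of_closure_eq [FiniteDimensional ℝ F] {s t : Set F} (ht : Convex ℝ t)
    (hs' : s = intrinsicInterior ℝ s) (ht' : t = intrinsicInterior ℝ t)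
    (h : closure s = closure t) : s ⊆ t := by
  intro v hv
  have hne : t.Nonempty := by
    rw [← closure_nonempty_iff, ← h]
    exact ⟨v, subset_closure hv⟩
  obtain ⟨b, hb⟩ := hne
  obtain ⟨δ, hδ, hball⟩ := exists_ball_of_mem_intrinsicInterior (ht' ▸ hb)
  obtain ⟨δ', hδ', hball'⟩ := exists_ball_of_mem_intrinsicInterior (hs' ▸ hv)
  have hbs : b ∈ affineSpan ℝ s :=
    closure_minimal (subset_affineSpan ℝ s)
      (AffineSubspace.closed_of_finiteDimensional _) (h ▸ subset_closure hb)
  obtain ⟨c, hc, hd, hvc⟩ := exists_dist_lt_mem_openSegment s (subset_affineSpan ℝ s hv)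
    hbs hδ'
  exact mem_of_mem_openSegment_closure ht hδ (subset_affineSpan ℝ t hb) hball
    (h ▸ subset_closure (hball' c hc hd)) hvc

/-- A face of a convex hull is spanned by the generators it contains. -/
lemma mem_convexHull_inter_of_isExtreme {U K : Set F}
    (h : IsExtreme ℝ (convexHull ℝ U) K) {z : F} (hz : z ∈ K) :
    z ∈ convexHull ℝ (U ∩ K) := by
  have hzU := h.1 hz
  have hd : convexHull ℝ (U \ K) ⊆ convexHull ℝ U \ K :=
    convexHull_min (fun x hx => ⟨subset_convexHull ℝ U hx.1, hx.2⟩)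
      (h.convex_sdiff (convex_convexHull ℝ U))
  rcases (U ∩ K).eq_empty_or_nonempty with h1 | h1
  · have : U \ K = U := by
      rw [sdiff_eq_left, Set.disjoint_iff_inter_eq_empty, h1]
    rw [this] at hd
    exact absurd hz (hd hzU).2
  rcases (U \ K).eq_empty_or_nonempty with h2 | h2
  · rwa [inter_eq_left.2 (sdiff_eq_empty.1 h2)]
  rw [← inter_union_sdiff U K, convexHull_union h1 h2, mem_convexJoin] at hzU
  obtain ⟨a, ha, b, hb, hab⟩ := hzU
  have hb' := hd hb
  rw [← insert_endpoints_openSegment] at hab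
  rcases hab with rfl | rfl | hab
  · exact ha
  · exact absurd hz hb'.2
  · exact absurd (h.right_mem_of_mem_openSegment
      (convexHull_mono inter_subset_left ha) hb'.1 hz hab) hb'.2

/-- The points of `R` that can be pushed across `y` inside `S` form a convex set. -/
lemma convex_setOf_openSegment {R S : Set F} (hR : Convex ℝ R) (hS : Convex ℝ S) (y : F) :
    Convex ℝ {x | x ∈ R ∧ ∃ c ∈ S, y ∈ openSegment ℝ x c} := by
  rw [convex_iff_openSegment_subset]
  rintro u ⟨hu, c, hc, a, b, ha, hb, hab, h1⟩ v ⟨hv, c', hc', a', b', ha', hb', hab', h2⟩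
    x ⟨m, n, hm, hn, hmn, rfl⟩
  refine ⟨hR hu hv hm.le hn.le hmn, ?_⟩
  have hD : 0 < m * a' + n * a := by positivity
  have hE : 0 < m * a' * b + n * a * b' := by positivity
  have hsum : a * a' + (m * a' * b + n * a * b') = m * a' + n * a := by
    have e1 : b = 1 - a := by linarith
    have e2 : b' = 1 - a' := by linarith
    subst e1 e2
    linear_combination (-a * a') * hmn
  refine ⟨(m * a' * b / (m * a' * b + n * a * b')) • c
      + (n * a * b' / (m * a' * b + n * a * b')) • c',
    hS hc hc' (by positivity) (by positivity) (by field_simp),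
    a * a' / (m * a' + n * a), (m * a' * b + n * a * b') / (m * a' + n * a),
    by positivity, by positivity, by rw [← add_div, hsum, div_self hD.ne'], ?_⟩
  have hyy : y = (m * a' / (m * a' + n * a)) • y + (n * a / (m * a' + n * a)) • y := by
    rw [← add_smul, ← add_div, div_self hD.ne', one_smul]
  have hyy' : y = (m * a' / (m * a' + n * a)) • (a • u + b • c)
      + (n * a / (m * a' + n * a)) • (a' • v + b' • c') := by rw [h1, h2, ← hyy]
  rw [hyy']
  simp only [smul_add, smul_smul]
  have f1 : (m * a' * b + n * a * b') / (m * a' + n * a) *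
      (m * a' * b / (m * a' * b + n * a * b')) = m * a' * b / (m * a' + n * a) := by field_simp
  have f2 : (m * a' * b + n * a * b') / (m * a' + n * a) *
      (n * a * b' / (m * a' * b + n * a * b')) = n * a * b' / (m * a' + n * a) := by field_simp
  rw [f1, f2]
  module

/-- If every `Z i` absorbs `X i`, and `y` has weight on every `Z i` relative to the convex hull
of the `X i`, then it does so relative to the convex hull of the `Z i`. -/
lemma mem_mix_convexHull_of_absorbing [FiniteDimensional ℝ F] {ι : Type*} {Λ : Set ι}
    {X Z : ι → Set F} (hZX : ∀ i ∈ Λ, Z i ⊆ X i)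
    (habs : ∀ i ∈ Λ, ∀ z ∈ Z i, ∀ x ∈ X i, openSegment ℝ z x ⊆ Z i)
    {y : F} (hy : ∀ i ∈ Λ, y ∈ mix (Z i) (convexHull ℝ (⋃ j ∈ Λ, X j))) :
    ∀ i ∈ Λ, y ∈ mix (Z i) (convexHull ℝ (⋃ j ∈ Λ, Z j)) := by
  intro i hi
  set S := convexHull ℝ (⋃ j ∈ Λ, X j) with hSdef
  have hS : Convex ℝ S := convex_convexHull ℝ _
  have hXS : ∀ j ∈ Λ, X j ⊆ S := fun j hj =>
    (subset_biUnion_of_mem (u := X) hj).trans (subset_convexHull ℝ _)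
  let K : Set F := {x | x ∈ S ∧ ∃ c ∈ S, y ∈ openSegment ℝ x c}
  have hK : IsExtreme ℝ S K := by
    refine ⟨fun x hx => hx.1, ?_⟩
    rintro u hu v hv x ⟨-, c, hc, hyx⟩ hx
    exact ⟨hu, exists_mem_openSegment_of_openSegment hS hv hc hx hyx⟩
  have hKc : Convex ℝ K := convex_setOf_openSegment hS hS y
  have hZK : ∀ j ∈ Λ, (Z j ∩ K).Nonempty := by
    intro j hj
    obtain ⟨u, hu, s, hs, h⟩ := hy j hj
    exact ⟨u, hu, hXS j hj (hZX j hj hu), s, hs, h⟩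
  set B := convexHull ℝ (⋃ j ∈ Λ, Z j) ∩ K with hBdef
  have hB : Convex ℝ B := (convex_convexHull ℝ _).inter hKc
  have hZB : ∀ j ∈ Λ, Z j ∩ K ⊆ B := fun j hj =>
    inter_subset_inter_left _
      ((subset_biUnion_of_mem (u := Z) hj).trans (subset_convexHull ℝ _))
  have hKB : K ⊆ closure B := by
    intro z hz
    refine convexHull_min ?_ hB.closure (mem_convexHull_inter_of_isExtreme hK hz)
    rintro x ⟨hx, hxK⟩
    obtain ⟨j, hj, hxj⟩ := mem_iUnion₂.1 hx
    obtain ⟨u, hu, huK⟩ := hZK j hj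
    have : openSegment ℝ u x ⊆ B := fun v hv =>
      hZB j hj ⟨habs j hj u hu x hxj hv, hKc.openSegment_subset huK hxK hv⟩
    have h2 := closure_mono this
    rw [closure_openSegment] at h2
    exact h2 (right_mem_segment ℝ u x)
  obtain ⟨u, hu, huK⟩ := hZK i hi
  have huB := hZB i hi ⟨hu, huK⟩
  obtain ⟨b₀, hb₀, H⟩ := exists_forall_mem_closure_openSegment hB ⟨u, huB⟩
  obtain ⟨hb₀S, c, hc, hyc⟩ := hb₀.2
  have hcK : c ∈ K := ⟨hc, b₀, hb₀S, by rwa [openSegment_symm]⟩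
  obtain ⟨c', hc', h⟩ := H c (hKB hcK) y hyc u huB
  exact ⟨u, hu, c', hc'.1, h⟩

end ConvexGeometry

section LevelSets

variable {Ω E : Type*}

lemma mem_level_self (ψ : ℕ → Ω → E) (t : ℕ) (ω : Ω) : ω ∈ level ψ t ω := fun _ _ => rfl

lemma level_symm {ψ : ℕ → Ω → E} {t : ℕ} {ω ω' : Ω} (h : ω' ∈ level ψ t ω) :
    ω ∈ level ψ t ω' := fun s hs => (h s hs).symm

lemma level_eq {ψ : ℕ → Ω → E} {t : ℕ} {ω ω' : Ω} (h : ω' ∈ level ψ t ω) :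
    level ψ t ω' = level ψ t ω := by
  ext x
  exact ⟨fun hx s hs => (hx s hs).trans (h s hs), fun hx s hs => (hx s hs).trans (h s hs).symm⟩

lemma level_anti (ψ : ℕ → Ω → E) {s t : ℕ} (hst : s ≤ t) (ω : Ω) :
    level ψ t ω ⊆ level ψ s ω := fun _ h r hr => h r (hr.trans hst)

/-- The σ-algebra of sets that do not separate `a` from `b`. -/
@[reducible] def nonSeparating (a b : Ω) : MeasurableSpace Ω where
  MeasurableSet' A := a ∈ A ↔ b ∈ A
  measurableSet_empty := by simp
  measurableSet_compl A h := by simp only [mem_compl_iff, h]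
  measurableSet_iUnion f h := by simp only [mem_iUnion, h]

/-- The point mass at `a`. -/
noncomputable def FinProb.dirac (a : Ω) : FinProb Ω where
  supp := {a}
  w := Set.indicator {a} 1
  pos := by simp
  zero := by simp
  sum_one := by simp

variable [MeasurableSpace E]

lemma natFilt_le_nonSeparating (ψ : ℕ → Ω → E) {t : ℕ} {a b : Ω} (h : b ∈ level ψ t a) :
    natFilt ψ t ≤ nonSeparating a b := by
  refine iSup₂_le fun s hs => ?_
  rintro _ ⟨B, -, rfl⟩
  change ψ s a ∈ B ↔ ψ s b ∈ B
  rw [h s (by simpa [Nat.lt_succ_iff] using hs)]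

lemma mem_of_measurableSet_filt {ψ : ℕ → Ω → E} {t : ℕ} {A : Set Ω}
    (hA : MeasurableSet[filt ψ t] A) {a b : Ω} (ha : a ∈ A) (h : b ∈ level ψ t a) : b ∈ A := by
  have h1 := MeasurableSpace.measurableSet_iInf.1 hA (FinProb.dirac a)
  have h2 : MeasurableSpace.generateFrom
      ({A | MeasurableSet[natFilt ψ t] A} ∪ nullSets ψ (FinProb.dirac a) t)
        ≤ nonSeparating a b := by
    refine MeasurableSpace.generateFrom_le ?_
    rintro B (hB | ⟨B', hBB', hB', h0⟩)
    · exact natFilt_le_nonSeparating ψ h B hB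
    · have haB : a ∉ B' := by
        intro haB
        simp [FinProb.meas, FinProb.dirac, Finset.filter_singleton, haB] at h0
      have hbB : b ∉ B' := fun hb => haB ((natFilt_le_nonSeparating ψ h B' hB').2 hb)
      exact ⟨fun hx => absurd (hBB' hx) haB, fun hx => absurd (hBB' hx) hbB⟩
  exact (h2 A h1).1 ha

lemma measurableSet_natFilt_level [MeasurableSingletonClass E] (ψ : ℕ → Ω → E) (t : ℕ) (ω : Ω) :
    MeasurableSet[natFilt ψ t] (level ψ t ω) := by
  have : level ψ t ω = ⋂ s ∈ Finset.range (t + 1), ψ s ⁻¹' {ψ s ω} := by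
    ext x
    simp [level]
  rw [this]
  refine @Finset.measurableSet_biInter _ _ (natFilt ψ t) _ _ fun s hs => ?_
  have hle : MeasurableSpace.comap (ψ s) inferInstance ≤ natFilt ψ t :=
    le_iSup₂_of_le s hs le_rfl
  exact hle _ ⟨_, measurableSet_singleton _, rfl⟩

lemma measurableSet_filt_of_saturated [MeasurableSingletonClass E] {ψ : ℕ → Ω → E} {t : ℕ}
    {A : Set Ω} (hA : ∀ a ∈ A, level ψ t a ⊆ A) : MeasurableSet[filt ψ t] A := by
  classical
  refine MeasurableSpace.measurableSet_iInf.2 fun P => ?_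
  have hlev : ∀ S : Finset Ω, MeasurableSet[natFilt ψ t] (⋃ ω ∈ S, level ψ t ω) := fun S =>
    @Finset.measurableSet_biUnion _ _ (natFilt ψ t) _ _ fun ω _ => measurableSet_natFilt_level ψ t ω
  set N : Set Ω := (⋃ ω ∈ P.supp, level ψ t ω)ᶜ with hN
  have hsplit : A = (⋃ ω ∈ P.supp.filter (fun ω => ω ∈ A), level ψ t ω) ∪ (A ∩ N) := by
    ext x
    constructor
    · intro hx
      by_cases hxN : x ∈ N
      · exact Or.inr ⟨hx, hxN⟩
      · rw [hN, notMem_compl_iff] at hxN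
        obtain ⟨ω, hω, hxω⟩ := mem_iUnion₂.1 hxN
        exact Or.inl (mem_iUnion₂.2
          ⟨ω, Finset.mem_filter.2 ⟨hω, hA x hx (level_symm hxω)⟩, hxω⟩)
    · rintro (hx | hx)
      · obtain ⟨ω, hω, hxω⟩ := mem_iUnion₂.1 hx
        exact hA ω (Finset.mem_filter.1 hω).2 hxω
      · exact hx.1
  rw [hsplit]
  refine @MeasurableSet.union _ (_) _ _
    (MeasurableSpace.measurableSet_generateFrom (Or.inl (hlev _)))
    (MeasurableSpace.measurableSet_generateFrom (Or.inr ⟨N, inter_subset_right,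
      @MeasurableSet.compl _ _ (natFilt ψ t) (hlev _), ?_⟩))
  refine Finset.sum_eq_zero fun ω hω => ?_
  obtain ⟨h1, h2⟩ := (@Finset.mem_filter _ _ (_) _ _).1 hω
  exact absurd (mem_iUnion₂.2 ⟨ω, h1, mem_level_self ψ t ω⟩) h2

lemma measurable_filt_of_level_const [MeasurableSingletonClass E] {F : Type*} [MeasurableSpace F]
    {ψ : ℕ → Ω → E} {t : ℕ} {ξ : Ω → F} (h : ∀ ω, ∀ ω' ∈ level ψ t ω, ξ ω' = ξ ω) :
    Measurable[filt ψ t] ξ := by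
  intro B _
  refine measurableSet_filt_of_saturated fun a ha b hb => ?_
  change ξ b ∈ B
  rw [h a b hb]
  exact ha

lemma closure_eq_of_corrMeasurable {F : Type*} [TopologicalSpace F] {ψ : ℕ → Ω → E} {t : ℕ}
    {U : Ω → Set F} (hU : CorrMeasurable (filt ψ t) U) {ω ω' : Ω} (h : ω' ∈ level ψ t ω) :
    closure (U ω') = closure (U ω) := by
  have key : ∀ a b, b ∈ level ψ t a → closure (U a) ⊆ closure (U b) := by
    intro a b hab x hx
    rw [mem_closure_iff] at hx ⊢
    intro O hO hxO
    have h1 : (U a ∩ O).Nonempty := by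
      rw [inter_comm]
      exact hx O hO hxO
    have h2 : (U b ∩ O).Nonempty := mem_of_measurableSet_filt (hU O hO) h1 hab
    rwa [inter_comm] at h2
  exact (key _ _ (level_symm h)).antisymm (key _ _ h)

end LevelSets

section Reachable

variable {Ω E : Type*} {d : ℕ}

/-- A pair of sequences of convex-valued correspondences that are constant on the level sets. -/
structure ConvexAdapted (ψ : ℕ → Ω → E) (T : ℕ) (V C : ℕ → Ω → Set (Fin d → ℝ)) : Prop where
  convex_left : ∀ t ≤ T, ∀ ω, Convex ℝ (V t ω)
  convex_right : ∀ t ≤ T, ∀ ω, Convex ℝ (C t ω)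
  level_left : ∀ t ≤ T, ∀ ω, ∀ ω' ∈ level ψ t ω, V t ω' = V t ω
  level_right : ∀ t ≤ T, ∀ ω, ∀ ω' ∈ level ψ t ω, C t ω' = C t ω

lemma IsMSP.convexAdapted [MeasurableSpace E] {ψ : ℕ → Ω → E} {T : ℕ}
    {V C : ℕ → Ω → Set (Fin d → ℝ)} (h : IsMSP ψ T V C) : ConvexAdapted ψ T V C where
  convex_left t ht ω := ((h t ht).2.2 ω).1
  convex_right t ht ω := ((h t ht).2.2 ω).2.2.2
  level_left t ht ω ω' hω := by
    obtain ⟨hV, -, h'⟩ := h t ht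
    have hc := closure_eq_of_corrMeasurable hV hω
    exact (subset_of_closure_eq (h' ω).1 (h' ω').2.1 (h' ω).2.1 hc).antisymm
      (subset_of_closure_eq (h' ω').1 (h' ω).2.1 (h' ω').2.1 hc.symm)
  level_right t ht ω ω' hω := by
    obtain ⟨-, hC, h'⟩ := h t ht
    have hc := closure_eq_of_corrMeasurable hC hω
    rwa [(h' ω).2.2.1.closure_eq, (h' ω').2.2.1.closure_eq] at hc

lemma mem_flat_iff {ψ : ℕ → Ω → E} {t : ℕ} {U : Ω → Set (Fin d → ℝ)} {ω : Ω} {y : Fin d → ℝ} :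
    y ∈ flat ψ t U ω ↔ ∀ ω' ∈ level ψ t ω, y ∈ mix (U ω') (sharp ψ t U ω) := by
  simp only [flat, mem_iInter₂, mem_iUnion₂, mem_mix_iff, exists_prop]

lemma convex_sharp (ψ : ℕ → Ω → E) (t : ℕ) (U : Ω → Set (Fin d → ℝ)) (ω : Ω) :
    Convex ℝ (sharp ψ t U ω) := convex_convexHull ℝ _

lemma sharp_mono {ψ : ℕ → Ω → E} {t : ℕ} {U U' : Ω → Set (Fin d → ℝ)} (h : ∀ ω, U ω ⊆ U' ω)
    (ω : Ω) : sharp ψ t U ω ⊆ sharp ψ t U' ω :=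
  convexHull_mono (iUnion₂_mono fun ω' _ => h ω')

lemma subset_sharp (ψ : ℕ → Ω → E) (t : ℕ) (U : Ω → Set (Fin d → ℝ)) {ω ω' : Ω}
    (h : ω' ∈ level ψ t ω) : U ω' ⊆ sharp ψ t U ω :=
  (subset_biUnion_of_mem (u := U) h).trans (subset_convexHull ℝ _)

lemma sharp_level {ψ : ℕ → Ω → E} {t : ℕ} (U : Ω → Set (Fin d → ℝ)) {ω ω' : Ω}
    (h : ω' ∈ level ψ t ω) : sharp ψ t U ω' = sharp ψ t U ω := by
  simp only [sharp, level_eq h]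

/-- The values at date `T - k` of solutions on the subtree issued from `ω`. -/
def reachSet (ψ : ℕ → Ω → E) (T : ℕ) (V C : ℕ → Ω → Set (Fin d → ℝ)) : ℕ → Ω → Set (Fin d → ℝ)
  | 0 => V T
  | (k + 1) => fun ω =>
      V (T - (k + 1)) ω ∩
        (sharp ψ (T - (k + 1)) (reachSet ψ T V C k) ω - C (T - (k + 1)) ω)

/-- The values at date `T - k` of solutions on the subtree issued from `ω` which charge `ω`. -/
def chargingSet (ψ : ℕ → Ω → E) (T : ℕ) (V C : ℕ → Ω → Set (Fin d → ℝ)) :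
    ℕ → Ω → Set (Fin d → ℝ)
  | 0 => V T
  | (k + 1) => fun ω =>
      V (T - (k + 1)) ω ∩
        (mix (chargingSet ψ T V C k ω) (sharp ψ (T - (k + 1)) (reachSet ψ T V C k) ω)
          - C (T - (k + 1)) ω)

variable {ψ : ℕ → Ω → E} {T : ℕ} {V C : ℕ → Ω → Set (Fin d → ℝ)}

lemma chargingSet_subset_reachSet (k : ℕ) (ω : Ω) :
    chargingSet ψ T V C k ω ⊆ reachSet ψ T V C k ω := by
  induction k generalizing ω with
  | zero => exact Subset.rfl
  | succ k ih =>
    exact inter_subset_inter_right _ (sub_subset_sub_right (mix_subset (convex_sharp _ _ _ _)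
      ((ih ω).trans (subset_sharp ψ _ _ (mem_level_self ψ _ ω)))))

lemma Wrev_subset_chargingSet (k : ℕ) (ω : Ω) :
    Wrev ψ T V C k ω ⊆ chargingSet ψ T V C k ω := by
  induction k generalizing ω with
  | zero => exact Subset.rfl
  | succ k ih =>
    refine inter_subset_inter_right _ (sub_subset_sub_right fun y hy => ?_)
    exact mix_mono (ih ω)
      (sharp_mono (fun ω' => (ih ω').trans (chargingSet_subset_reachSet k ω')) ω)
      (mem_flat_iff.1 hy ω (mem_level_self ψ _ ω))

lemma ConvexAdapted.reachSet_convex (h : ConvexAdapted ψ T V C) (k : ℕ) (ω : Ω) :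
    Convex ℝ (reachSet ψ T V C k ω) := by
  cases k with
  | zero => exact h.convex_left T le_rfl ω
  | succ k =>
    exact (h.convex_left _ (Nat.sub_le _ _) ω).inter
      ((convex_sharp _ _ _ _).sub (h.convex_right _ (Nat.sub_le _ _) ω))

lemma ConvexAdapted.reachSet_level (h : ConvexAdapted ψ T V C) (k : ℕ) {ω ω' : Ω}
    (hω : ω' ∈ level ψ (T - k) ω) : reachSet ψ T V C k ω' = reachSet ψ T V C k ω := by
  cases k with
  | zero => exact h.level_left T le_rfl ω ω' hω
  | succ k =>
    simp only [reachSet, sharp_level _ hω, h.level_left _ (Nat.sub_le _ _) ω ω' hω,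
      h.level_right _ (Nat.sub_le _ _) ω ω' hω]

lemma ConvexAdapted.openSegment_subset_chargingSet (h : ConvexAdapted ψ T V C) (k : ℕ) {ω : Ω}
    {p x : Fin d → ℝ} (hp : p ∈ chargingSet ψ T V C k ω) (hx : x ∈ reachSet ψ T V C k ω) :
    openSegment ℝ p x ⊆ chargingSet ψ T V C k ω := by
  cases k with
  | zero => exact (h.convex_left T le_rfl ω).openSegment_subset hp hx
  | succ k =>
    obtain ⟨hpV, a, ha, c, hc, rfl⟩ := hp
    obtain ⟨hxV, s, hs, c', hc', rfl⟩ := hx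
    intro y hy
    refine ⟨(h.convex_left _ (Nat.sub_le _ _) ω).openSegment_subset hpV hxV hy, ?_⟩
    obtain ⟨m, n, hm, hn, hmn, rfl⟩ := hy
    refine ⟨m • a + n • s, mem_mix_of_mem_openSegment (convex_sharp _ _ _ _) ha hs
      ⟨m, n, hm, hn, hmn, rfl⟩, m • c + n • c',
      h.convex_right _ (Nat.sub_le _ _) ω hc hc' hm.le hn.le hmn, ?_⟩
    simp only
    module

/-- If every leaf below `ω` is charged by a solution, then all of them have a common value. -/
lemma ConvexAdapted.exists_common (h : ConvexAdapted ψ T V C) (k : ℕ) (ω : Ω)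
    (hne : ∀ ω' ∈ level ψ (T - k) ω, (chargingSet ψ T V C k ω').Nonempty) :
    (⋂ ω' ∈ level ψ (T - k) ω, chargingSet ψ T V C k ω').Nonempty := by
  have hX : (reachSet ψ T V C k ω).Nonempty :=
    (hne ω (mem_level_self ψ _ ω)).mono (chargingSet_subset_reachSet k ω)
  obtain ⟨x, hx, H⟩ := exists_forall_mem_openSegment (h.reachSet_convex k ω) hX
  refine ⟨x, mem_iInter₂.2 fun ω' hω' => ?_⟩
  obtain ⟨a, ha⟩ := hne ω' hω'
  have hlev := h.reachSet_level k hω'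
  obtain ⟨c, hc, hxc⟩ := H a (hlev ▸ chargingSet_subset_reachSet k ω' ha)
  exact h.openSegment_subset_chargingSet k ha (hlev ▸ hc) hxc

/-- A point having weight on every leaf has weight on the common values of every node. -/
lemma ConvexAdapted.mem_mix_iInter (h : ConvexAdapted ψ T V C) {k t : ℕ} (ht : t ≤ T - k)
    {ω : Ω} {y : Fin d → ℝ}
    (hy : ∀ ω' ∈ level ψ t ω, y ∈ mix (chargingSet ψ T V C k ω')
      (sharp ψ t (reachSet ψ T V C k) ω)) :
    ∀ i ∈ level ψ t ω, y ∈ mix (⋂ ω' ∈ level ψ (T - k) i, chargingSet ψ T V C k ω')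
      (sharp ψ t (fun j => ⋂ ω' ∈ level ψ (T - k) j, chargingSet ψ T V C k ω') ω) := by
  set S := sharp ψ t (reachSet ψ T V C k) ω with hSdef
  have hS : Convex ℝ S := convex_sharp _ _ _ _
  refine mem_mix_convexHull_of_absorbing (X := reachSet ψ T V C k)
    (fun j _ => (iInter₂_subset j (mem_level_self ψ _ j)).trans
      (chargingSet_subset_reachSet k j)) ?_ ?_
  · intro j _ z hz x hx v hv
    refine mem_iInter₂.2 fun ω' hω' => ?_
    exact h.openSegment_subset_chargingSet k (mem_iInter₂.1 hz ω' hω')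
      ((h.reachSet_level k hω').symm ▸ hx) hv
  · intro i hi
    have hsub : ∀ ω' ∈ level ψ (T - k) i, ω' ∈ level ψ t ω := fun ω' hω' =>
      level_eq hi ▸ level_anti ψ ht i hω'
    let D : Set (Fin d → ℝ) := {x | x ∈ reachSet ψ T V C k i ∧ ∃ s ∈ S, y ∈ openSegment ℝ x s}
    have hD : ∀ ω' ∈ level ψ (T - k) i, (D ∩ chargingSet ψ T V C k ω').Nonempty := by
      intro ω' hω'
      obtain ⟨u, hu, s, hs, hys⟩ := hy ω' (hsub ω' hω')
      exact ⟨u, ⟨h.reachSet_level k hω' ▸ chargingSet_subset_reachSet k ω' hu, s, hs, hys⟩, hu⟩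
    have hDc : Convex ℝ D := convex_setOf_openSegment (h.reachSet_convex k i) hS y
    obtain ⟨x, hx, H⟩ := exists_forall_mem_openSegment hDc
      ((hD i (mem_level_self ψ _ i)).mono inter_subset_left)
    obtain ⟨hxX, s, hs, hys⟩ := hx
    refine ⟨x, mem_iInter₂.2 fun ω' hω' => ?_, s, hs, hys⟩
    obtain ⟨u, huD, hu⟩ := hD ω' hω'
    obtain ⟨c, hc, hxc⟩ := H u huD
    exact h.openSegment_subset_chargingSet k hu ((h.reachSet_level k hω').symm ▸ hc.1) hxc

/-- Values that charge every leaf below `ω` belong to `W`. -/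
lemma ConvexAdapted.iInter_chargingSet_subset_Wrev (h : ConvexAdapted ψ T V C) (k : ℕ) (ω : Ω) :
    ⋂ ω' ∈ level ψ (T - k) ω, chargingSet ψ T V C k ω' ⊆ Wrev ψ T V C k ω := by
  induction k generalizing ω with
  | zero => exact iInter₂_subset ω (mem_level_self ψ _ ω)
  | succ k ih =>
    intro x hx
    rw [mem_iInter₂] at hx
    set t := T - (k + 1) with ht
    set S := sharp ψ t (reachSet ψ T V C k) ω with hSdef
    have hS : Convex ℝ S := convex_sharp _ _ _ _
    have hkS : ∀ ω' ∈ level ψ t ω, chargingSet ψ T V C k ω' ⊆ S := fun ω' hω' =>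
      (chargingSet_subset_reachSet k ω').trans (subset_sharp ψ t _ hω')
    refine ⟨(hx ω (mem_level_self ψ _ ω)).1, ?_⟩
    have hA : Convex ℝ (S ∩ ({x} + C t ω)) :=
      hS.inter ((convex_singleton x).add (h.convex_right t (Nat.sub_le _ _) ω))
    have hmeet : ∀ ω' ∈ level ψ t ω, ∃ a ∈ S ∩ ({x} + C t ω),
        a ∈ mix (chargingSet ψ T V C k ω') S := by
      intro ω' hω'
      obtain ⟨-, a, ha, c, hc, hac⟩ := hx ω' hω'
      rw [← ht, sharp_level _ hω'] at ha
      rw [← ht, h.level_right t (Nat.sub_le _ _) ω ω' hω'] at hc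
      exact ⟨a, ⟨mix_subset hS (hkS ω' hω') ha, x, rfl, c, hc, by simp [← hac]⟩, ha⟩
    obtain ⟨a₀, ha₀, -⟩ := hmeet ω (mem_level_self ψ _ ω)
    obtain ⟨y, ⟨hyS, x', hx', c, hc, hxc⟩, H⟩ := exists_forall_mem_openSegment hA ⟨a₀, ha₀⟩
    obtain rfl : x' = x := hx'
    refine ⟨y, mem_flat_iff.2 fun i hi => ?_, c, hc, by simp [← hxc]⟩
    have hy : ∀ ω' ∈ level ψ t ω, y ∈ mix (chargingSet ψ T V C k ω') S := by
      intro ω' hω'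
      obtain ⟨a, haA, ha⟩ := hmeet ω' hω'
      obtain ⟨b, hb, hyb⟩ := H a haA
      exact mem_mix_of_mem_openSegment hS ha hb.1 hyb
    exact mix_mono (ih i) (sharp_mono ih ω)
      (h.mem_mix_iInter (show t ≤ T - k by omega) hy i hi)

end Reachable

section Solutions

variable {Ω E : Type*} {d : ℕ}

lemma sum_smul_mem_mix {ι F : Type*} [AddCommGroup F] [Module ℝ F] {U S : Set F}
    (hS : Convex ℝ S) (s : Finset ι) (p : ι → ℝ) (x : ι → F) (hp : ∀ j ∈ s, 0 < p j)
    (h1 : ∑ j ∈ s, p j = 1) (hx : ∀ j ∈ s, x j ∈ S) {i : ι} (hi : i ∈ s) (hU : x i ∈ U) :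
    ∑ j ∈ s, p j • x j ∈ mix U S := by
  classical
  have hpi := hp i hi
  have hle : p i ≤ 1 := h1 ▸ Finset.single_le_sum (fun j hj => (hp j hj).le) hi
  set l := p i / 2 with hl
  have hl0 : 0 < l := by positivity
  have hl1 : 0 < 1 - l := by linarith
  have hr : ∑ j ∈ s, ((p j - if j = i then l else 0) / (1 - l)) • x j ∈ S := by
    refine hS.sum_mem (fun j hj => div_nonneg ?_ hl1.le) ?_ hx
    · split_ifs with h
      · subst h
        linarith
      · linarith [hp j hj]
    · rw [← Finset.sum_div, Finset.sum_sub_distrib, h1, Finset.sum_ite_eq' s i, if_pos hi,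
        div_self hl1.ne']
  refine ⟨x i, hU, _, hr, l, 1 - l, hl0, hl1, by ring, ?_⟩
  rw [Finset.smul_sum]
  have : ∀ j ∈ s, (1 - l) • ((p j - if j = i then l else 0) / (1 - l)) • x j
      = p j • x j - if j = i then l • x i else 0 := by
    intro j _
    rw [smul_smul, mul_div_cancel₀ _ hl1.ne', sub_smul]
    split_ifs with h
    · rw [h]
    · rw [zero_smul]
  rw [Finset.sum_congr rfl this, Finset.sum_sub_distrib, Finset.sum_ite_eq' s i, if_pos hi,
    add_sub_cancel]

lemma condExp_mem_mix {F : Type*} [AddCommGroup F] [Module ℝ F] {U S : Set F} (hS : Convex ℝ S)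
    {ψ : ℕ → Ω → E} {t : ℕ} {Q : FinProb Ω} {ξ : Ω → F} {ω : Ω} (hω : ω ∈ Q.supp)
    (hx : ∀ ω' ∈ Q.supp, ω' ∈ level ψ t ω → ξ ω' ∈ S) (hU : ξ ω ∈ U) :
    condExp ψ t Q ξ ω ∈ mix U S := by
  let _ := Classical.decPred fun ω' => ω' ∈ level ψ t ω
  have hmem : ω ∈ Q.supp.filter (fun ω' => ω' ∈ level ψ t ω) :=
    Finset.mem_filter.2 ⟨hω, mem_level_self ψ t ω⟩
  have hpos : 0 < Q.meas (level ψ t ω) :=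
    Finset.sum_pos (fun j hj => Q.pos j (Finset.mem_filter.1 hj).1) ⟨ω, hmem⟩
  have := sum_smul_mem_mix hS (Q.supp.filter (fun ω' => ω' ∈ level ψ t ω))
    (fun j => (Q.meas (level ψ t ω))⁻¹ * Q.w j) ξ
    (fun j hj => mul_pos (inv_pos.2 hpos) (Q.pos j (Finset.mem_filter.1 hj).1))
    (by rw [← Finset.mul_sum]; exact inv_mul_cancel₀ hpos.ne')
    (fun j hj => hx j (Finset.mem_filter.1 hj).1 (Finset.mem_filter.1 hj).2) hmem hU
  simpa only [condExp, Finset.smul_sum, smul_smul] using this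

lemma IsSolution.mem_chargingSet [MeasurableSpace E] {ψ : ℕ → Ω → E} {T : ℕ}
    {V C : ℕ → Ω → Set (Fin d → ℝ)} {ξ : ℕ → Ω → (Fin d → ℝ)} {Q : FinProb Ω}
    (h : IsSolution ψ T V C ξ Q) {k : ℕ} (hk : k ≤ T) {ω : Ω} (hω : ω ∈ Q.supp) :
    ξ (T - k) ω ∈ chargingSet ψ T V C k ω := by
  induction k generalizing ω with
  | zero => exact (h.1 T le_rfl).2 ω
  | succ k ih =>
    have ht : T - (k + 1) + 1 = T - k := by omega
    refine ⟨(h.1 _ (Nat.sub_le _ _)).2 ω, _, ?_, _, h.2 (T - (k + 1)) (by omega) ω hω,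
      sub_sub_cancel _ _⟩
    rw [ht]
    exact condExp_mem_mix (convex_sharp _ _ _ _) hω
      (fun ω' hω' hl => subset_sharp ψ _ _ hl
        (chargingSet_subset_reachSet k ω' (ih (by omega) hω'))) (ih (by omega) hω)

end Solutions

section Gluing

variable {Ω E : Type*} {d : ℕ}

open scoped Classical in
/-- The sum over a set `L` of a finitely supported function. -/
noncomputable def sumOn {F : Type*} [AddCommGroup F] [Module ℝ F] (L : Set Ω) :
    (Ω →₀ F) →ₗ[ℝ] F :=
  Finsupp.lsum ℝ fun ω => if ω ∈ L then LinearMap.id else 0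

open scoped Classical in
lemma sumOn_apply {F : Type*} [AddCommGroup F] [Module ℝ F] (L : Set Ω) (f : Ω →₀ F)
    {s : Finset Ω} (hs : f.support ⊆ s) : sumOn L f = ∑ ω ∈ s with ω ∈ L, f ω := by
  rw [sumOn, Finsupp.lsum_apply, Finsupp.sum_of_support_subset f hs _ (by simp),
    Finset.sum_filter]
  refine Finset.sum_congr rfl fun ω _ => ?_
  split_ifs <;> rfl

lemma sumOn_congr {F : Type*} [AddCommGroup F] [Module ℝ F] {L L' : Set Ω} {f : Ω →₀ F}
    (h : ∀ ω, f ω ≠ 0 → (ω ∈ L ↔ ω ∈ L')) : sumOn L f = sumOn L' f := by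
  classical
  rw [sumOn_apply L f Finset.Subset.rfl, sumOn_apply L' f Finset.Subset.rfl]
  congr 1
  refine Finset.filter_congr fun ω hω => h ω (Finsupp.mem_support_iff.1 hω)

lemma sumOn_eq_zero {F : Type*} [AddCommGroup F] [Module ℝ F] {L : Set Ω} {f : Ω →₀ F}
    (h : ∀ ω ∈ L, f ω = 0) : sumOn L f = 0 := by
  classical
  rw [sumOn_apply L f Finset.Subset.rfl]
  exact Finset.sum_eq_zero fun ω hω => h ω (Finset.mem_filter.1 hω).2

lemma sumOn_nonneg {L : Set Ω} {q : Ω →₀ ℝ} (h : ∀ ω, 0 ≤ q ω) : 0 ≤ sumOn L q := by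
  classical
  rw [sumOn_apply L q Finset.Subset.rfl]
  exact Finset.sum_nonneg fun ω _ => h ω

lemma sumOn_pos {L : Set Ω} {q : Ω →₀ ℝ} (h : ∀ ω, 0 ≤ q ω) {ω : Ω} (hω : ω ∈ L)
    (hq : 0 < q ω) : 0 < sumOn L q := by
  classical
  rw [sumOn_apply L q Finset.Subset.rfl]
  exact Finset.sum_pos' (fun ω _ => h ω)
    ⟨ω, Finset.mem_filter.2 ⟨Finsupp.mem_support_iff.2 hq.ne', hω⟩, hq⟩

/-- The function `ω ↦ q ω • x`. -/
noncomputable def spread {F : Type*} [AddCommGroup F] [Module ℝ F] (x : F) (q : Ω →₀ ℝ) :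
    Ω →₀ F :=
  q.mapRange (fun r => r • x) (zero_smul ℝ x)

lemma sumOn_spread {F : Type*} [AddCommGroup F] [Module ℝ F] (L : Set Ω) (x : F) (q : Ω →₀ ℝ) :
    sumOn L (spread x q) = sumOn L q • x := by
  classical
  rw [sumOn_apply L q Finset.Subset.rfl,
    sumOn_apply L (spread x q) (Finsupp.support_mapRange), Finset.sum_smul]
  rfl

/-- An unnormalised solution from date `t` on: a finitely supported weight `q` and functions
`ζ s`, whose sums over the level sets are the values of a solution multiplied by the mass. -/
structure IsFlow (ψ : ℕ → Ω → E) (T : ℕ) (V C : ℕ → Ω → Set (Fin d → ℝ)) (t : ℕ)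
    (q : Ω →₀ ℝ) (ζ : ℕ → Ω →₀ (Fin d → ℝ)) : Prop where
  nonneg : ∀ ω, 0 ≤ q ω
  support : ∀ s, t ≤ s → s ≤ T → ∀ ω, q ω = 0 → ζ s ω = 0
  value : ∀ s, t ≤ s → s ≤ T → ∀ ω,
    sumOn (level ψ s ω) (ζ s) ∈ sumOn (level ψ s ω) q • V s ω
  drift : ∀ s, t ≤ s → s + 1 ≤ T → ∀ ω,
    sumOn (level ψ s ω) (ζ (s + 1)) - sumOn (level ψ s ω) (ζ s) ∈ sumOn (level ψ s ω) q • C s ω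

variable {ψ : ℕ → Ω → E} {T : ℕ} {V C : ℕ → Ω → Set (Fin d → ℝ)}

lemma IsFlow.smul {t : ℕ} {q : Ω →₀ ℝ} {ζ : ℕ → Ω →₀ (Fin d → ℝ)}
    (h : IsFlow ψ T V C t q ζ) {a : ℝ} (ha : 0 ≤ a) :
    IsFlow ψ T V C t (a • q) (fun s => a • ζ s) where
  nonneg ω := mul_nonneg ha (h.nonneg ω)
  support s h1 h2 ω h0 := by
    rcases mul_eq_zero.1 (show a * q ω = 0 from h0) with h0 | h0
    · simp [h0]
    · simp [h.support s h1 h2 ω h0]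
  value s h1 h2 ω := by
    rw [map_smul, map_smul, smul_eq_mul, mul_smul]
    exact smul_mem_smul_set (h.value s h1 h2 ω)
  drift s h1 h2 ω := by
    rw [map_smul, map_smul, map_smul, smul_eq_mul, mul_smul, ← smul_sub]
    exact smul_mem_smul_set (h.drift s h1 h2 ω)

lemma IsFlow.add (hVC : ConvexAdapted ψ T V C) {t : ℕ} {q q' : Ω →₀ ℝ}
    {ζ ζ' : ℕ → Ω →₀ (Fin d → ℝ)} (h : IsFlow ψ T V C t q ζ) (h' : IsFlow ψ T V C t q' ζ') :
    IsFlow ψ T V C t (q + q') (fun s => ζ s + ζ' s) where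
  nonneg ω := add_nonneg (h.nonneg ω) (h'.nonneg ω)
  support s h1 h2 ω h0 := by
    have e : q ω + q' ω = 0 := h0
    have e1 : q ω = 0 := by linarith [h.nonneg ω, h'.nonneg ω]
    have e2 : q' ω = 0 := by linarith [h.nonneg ω, h'.nonneg ω]
    simp [h.support s h1 h2 ω e1, h'.support s h1 h2 ω e2]
  value s h1 h2 ω := by
    rw [map_add, map_add, (hVC.convex_left s h2 ω).add_smul (sumOn_nonneg h.nonneg)
      (sumOn_nonneg h'.nonneg)]
    exact add_mem_add (h.value s h1 h2 ω) (h'.value s h1 h2 ω)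
  drift s h1 h2 ω := by
    rw [map_add, map_add, map_add, (hVC.convex_right s (by omega) ω).add_smul
      (sumOn_nonneg h.nonneg) (sumOn_nonneg h'.nonneg), add_sub_add_comm]
    exact add_mem_add (h.drift s h1 h2 ω) (h'.drift s h1 h2 ω)

/-- The initial values at date `t` of normalised flows carried by `L` and charging `D`. -/
def flowSet (ψ : ℕ → Ω → E) (T : ℕ) (V C : ℕ → Ω → Set (Fin d → ℝ)) (t : ℕ) (L D : Set Ω) :
    Set (Fin d → ℝ) :=
  {y | ∃ q ζ, IsFlow ψ T V C t q ζ ∧ (∀ ω, q ω ≠ 0 → ω ∈ L) ∧ (∀ ω ∈ D, 0 < q ω) ∧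
    sumOn univ q = 1 ∧ sumOn univ (ζ t) = y}

lemma flowSet_mono {t : ℕ} {L L' D D' : Set Ω} (hL : L ⊆ L') (hD : D' ⊆ D) :
    flowSet ψ T V C t L D ⊆ flowSet ψ T V C t L' D' := by
  rintro y ⟨q, ζ, h, h1, h2, h3⟩
  exact ⟨q, ζ, h, fun ω hω => hL (h1 ω hω), fun ω hω => h2 ω (hD hω), h3⟩

lemma ConvexAdapted.openSegment_subset_flowSet (hVC : ConvexAdapted ψ T V C) {t : ℕ}
    {L D : Set Ω} {y y' : Fin d → ℝ} (hy : y ∈ flowSet ψ T V C t L D)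
    (hy' : y' ∈ flowSet ψ T V C t L ∅) : openSegment ℝ y y' ⊆ flowSet ψ T V C t L D := by
  obtain ⟨q, ζ, h, hL, hD, h1, rfl⟩ := hy
  obtain ⟨q', ζ', h', hL', -, h1', rfl⟩ := hy'
  rintro _ ⟨a, b, ha, hb, hab, rfl⟩
  refine ⟨a • q + b • q', _, (h.smul ha.le).add hVC (h'.smul hb.le), ?_, ?_, ?_, ?_⟩
  · intro ω hω
    by_cases h0 : q ω = 0
    · refine hL' ω fun h0' => hω ?_
      simp [h0, h0']
    · exact hL ω h0
  · intro ω hω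
    exact add_pos_of_pos_of_nonneg (mul_pos ha (hD ω hω)) (mul_nonneg hb.le (h'.nonneg ω))
  · rw [map_add, map_smul, map_smul, h1, h1', smul_eq_mul, smul_eq_mul, mul_one, mul_one, hab]
  · rw [map_add, map_smul, map_smul]

lemma ConvexAdapted.convex_flowSet (hVC : ConvexAdapted ψ T V C) (t : ℕ) (L : Set Ω) :
    Convex ℝ (flowSet ψ T V C t L ∅) :=
  convex_iff_openSegment_subset.2 fun _ hx _ hy => hVC.openSegment_subset_flowSet hx hy

lemma sumOn_level_smul_mem {U : Ω → Set (Fin d → ℝ)} {t : ℕ} (hne : ∀ ω, (U ω).Nonempty)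
    (hU : ∀ ω, ∀ ω' ∈ level ψ t ω, U ω' = U ω) {q : Ω →₀ ℝ} {f : Ω →₀ (Fin d → ℝ)}
    (hf : ∀ ω, q ω = 0 → f ω = 0) {ω₀ : Ω} (hq : ∀ ω, q ω ≠ 0 → ω ∈ level ψ t ω₀)
    (h1 : sumOn univ q = 1) (hmem : sumOn univ f ∈ U ω₀) (ω : Ω) :
    sumOn (level ψ t ω) f ∈ sumOn (level ψ t ω) q • U ω := by
  by_cases h : ω ∈ level ψ t ω₀
  · have hiff : ∀ ω', q ω' ≠ 0 → (ω' ∈ level ψ t ω ↔ ω' ∈ (univ : Set Ω)) := fun ω' h0 =>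
      ⟨fun _ => trivial, fun _ => level_eq h ▸ hq ω' h0⟩
    rw [sumOn_congr hiff, sumOn_congr (f := f) fun ω' h0 => hiff ω' (mt (hf ω') h0), h1, one_smul,
      hU ω₀ ω h]
    exact hmem
  · have hz : ∀ ω' ∈ level ψ t ω, q ω' = 0 := by
      intro ω' hω'
      by_contra h0
      have := level_symm hω'
      rw [level_eq (hq ω' h0)] at this
      exact h this
    rw [sumOn_eq_zero hz, sumOn_eq_zero fun ω' hω' => hf ω' (hz ω' hω'), zero_smul_set (hne ω)]
    exact zero_mem_zero

lemma ConvexAdapted.mem_flowSet_terminal (hVC : ConvexAdapted ψ T V C)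
    (hV : ∀ t ≤ T, ∀ ω, (V t ω).Nonempty) {ω : Ω} {x : Fin d → ℝ} (hx : x ∈ V T ω) :
    x ∈ flowSet ψ T V C T (level ψ T ω) {ω} := by
  classical
  have hq : ∀ ω', Finsupp.single ω (1 : ℝ) ω' ≠ 0 → ω' ∈ level ψ T ω := by
    intro ω' h
    by_cases hω : ω = ω'
    · exact hω ▸ mem_level_self ψ T ω
    · exact absurd (Finsupp.single_eq_of_ne' hω) h
  have h1 : sumOn univ (Finsupp.single ω (1 : ℝ)) = 1 := by simp [sumOn]
  have hz : ∀ ω', Finsupp.single ω (1 : ℝ) ω' = 0 →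
      spread x (Finsupp.single ω (1 : ℝ)) ω' = 0 := by
    intro ω' h
    simp only [spread, Finsupp.mapRange_apply, h, zero_smul]
  have hs : sumOn univ (spread x (Finsupp.single ω (1 : ℝ))) = x := by
    rw [sumOn_spread, h1, one_smul]
  refine ⟨Finsupp.single ω 1, fun _ => spread x (Finsupp.single ω 1), ⟨?_, ?_, ?_, ?_⟩, hq, ?_,
    h1, hs⟩
  · intro ω'
    rw [Finsupp.single_apply]
    split_ifs <;> norm_num
  · exact fun _ _ _ => hz
  · intro s hs1 hs2 ω'
    obtain rfl : s = T := le_antisymm hs2 hs1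
    exact sumOn_level_smul_mem (hV s le_rfl) (hVC.level_left s le_rfl) hz hq h1
      (by rwa [hs]) ω'
  · intro s hs1 hs2
    omega
  · rintro _ rfl
    simp

lemma ConvexAdapted.mem_flowSet_step (hVC : ConvexAdapted ψ T V C)
    (hV : ∀ t ≤ T, ∀ ω, (V t ω).Nonempty) {t : ℕ} (ht : t + 1 ≤ T)
    (hC : ∀ ω, (C t ω).Nonempty) {ω : Ω} {D : Set Ω} {x y : Fin d → ℝ} (hx : x ∈ V t ω)
    (hy : y ∈ flowSet ψ T V C (t + 1) (level ψ t ω) D) (hyx : y - x ∈ C t ω) :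
    x ∈ flowSet ψ T V C t (level ψ t ω) D := by
  classical
  obtain ⟨q, ζ, h, hL, hD, h1, rfl⟩ := hy
  have hz : ∀ ω', q ω' = 0 → spread x q ω' = 0 := by
    intro ω' h
    simp only [spread, Finsupp.mapRange_apply, h, zero_smul]
  have hs : sumOn univ (spread x q) = x := by rw [sumOn_spread, h1, one_smul]
  refine ⟨q, Function.update ζ t (spread x q), ⟨h.nonneg, ?_, ?_, ?_⟩, hL, hD, h1, ?_⟩
  · intro s h2 h3 ω' h0
    rcases h2.eq_or_lt with rfl | h2
    · rw [Function.update_self]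
      exact hz ω' h0
    · rw [Function.update_of_ne h2.ne']
      exact h.support s h2 h3 ω' h0
  · intro s h2 h3 ω'
    rcases h2.eq_or_lt with rfl | h2
    · rw [Function.update_self]
      exact sumOn_level_smul_mem (hV t h3) (hVC.level_left t h3) hz hL h1 (by rwa [hs]) ω'
    · rw [Function.update_of_ne h2.ne']
      exact h.value s h2 h3 ω'
  · intro s h2 h3 ω'
    rcases h2.eq_or_lt with rfl | h2
    · rw [Function.update_self, Function.update_of_ne (by omega), ← map_sub]
      refine sumOn_level_smul_mem hC (hVC.level_right t (by omega)) ?_ hL h1 ?_ ω'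
      · intro ω'' h0
        rw [Finsupp.sub_apply, hz ω'' h0, h.support _ le_rfl ht ω'' h0, sub_zero]
      · rwa [map_sub, hs]
    · rw [Function.update_of_ne h2.ne', Function.update_of_ne (by omega)]
      exact h.drift s h2 h3 ω'
  · rw [Function.update_self, hs]

lemma ConvexAdapted.subset_flowSet (hVC : ConvexAdapted ψ T V C)
    (hV : ∀ t ≤ T, ∀ ω, (V t ω).Nonempty) (hC : ∀ t, t + 1 ≤ T → ∀ ω, (C t ω).Nonempty)
    {k : ℕ} (hk : k ≤ T) (ω : Ω) :
    reachSet ψ T V C k ω ⊆ flowSet ψ T V C (T - k) (level ψ (T - k) ω) ∅ ∧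
      chargingSet ψ T V C k ω ⊆ flowSet ψ T V C (T - k) (level ψ (T - k) ω) {ω} := by
  induction k generalizing ω with
  | zero =>
    have := fun x (hx : x ∈ V T ω) => hVC.mem_flowSet_terminal hV hx
    exact ⟨fun x hx => flowSet_mono Subset.rfl (empty_subset _) (this x hx), this⟩
  | succ k ih =>
    have ht : T - (k + 1) + 1 = T - k := by omega
    have ht' : T - (k + 1) + 1 ≤ T := by omega
    have hsharp : sharp ψ (T - (k + 1)) (reachSet ψ T V C k) ω ⊆
        flowSet ψ T V C (T - (k + 1) + 1) (level ψ (T - (k + 1)) ω) ∅ := by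
      refine convexHull_min (iUnion₂_subset fun i hi => ?_) (hVC.convex_flowSet _ _)
      rw [ht]
      refine ((ih (by omega) i).1).trans (flowSet_mono ?_ Subset.rfl)
      exact level_eq hi ▸ level_anti ψ (by omega) i
    constructor
    · rintro x ⟨hxV, s, hs, c, hc, rfl⟩
      exact hVC.mem_flowSet_step hV ht' (hC _ ht') hxV (hsharp hs) (by simpa using hc)
    · rintro x ⟨hxV, s, ⟨u, hu, v, hv, hs⟩, c, hc, rfl⟩
      refine hVC.mem_flowSet_step hV ht' (hC _ ht') hxV
        (hVC.openSegment_subset_flowSet ?_ (hsharp hv) hs) (by simpa using hc)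
      rw [ht]
      exact flowSet_mono (level_anti ψ (by omega) ω) Subset.rfl ((ih (by omega) ω).2 hu)

open scoped Classical in
/-- The values carried by a flow, completed by arbitrary choices off its support. -/
noncomputable def flowValue (ψ : ℕ → Ω → E) (V : ℕ → Ω → Set (Fin d → ℝ)) (q : Ω →₀ ℝ)
    (ζ : ℕ → Ω →₀ (Fin d → ℝ)) (t : ℕ) (ω : Ω) : Fin d → ℝ :=
  if 0 < sumOn (level ψ t ω) q then
    (sumOn (level ψ t ω) q)⁻¹ • sumOn (level ψ t ω) (ζ t)
  else if h : (V t ω).Nonempty then h.some else 0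

open scoped Classical in
/-- Averaging over the cells of level `t` does not change sums over unions of such cells. -/
lemma sum_smul_average {q : Ω →₀ ℝ} (hq : ∀ ω, 0 ≤ q ω) {f : Ω →₀ (Fin d → ℝ)}
    (hf : ∀ ω, q ω = 0 → f ω = 0) {s t : ℕ} (hst : s ≤ t) (ω : Ω) :
    ∑ ω' ∈ q.support with ω' ∈ level ψ s ω,
      q ω' • (sumOn (level ψ t ω') q)⁻¹ • sumOn (level ψ t ω') f = sumOn (level ψ s ω) f := by
  classical
  have hsub : f.support ⊆ q.support := fun ω' h => by
    rw [Finsupp.mem_support_iff] at h ⊢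
    exact mt (hf ω') h
  set A := q.support.filter (fun ω' => ω' ∈ level ψ s ω) with hA
  have key : ∀ a ∈ A, ∀ {F : Type} [AddCommGroup F] [Module ℝ F] (g : Ω →₀ F),
      g.support ⊆ q.support →
      sumOn (level ψ t a) g = ∑ b ∈ A, if b ∈ level ψ t a then g b else 0 := by
    intro a ha F _ _ g hg
    rw [sumOn_apply _ g hg, ← Finset.sum_filter, hA, Finset.filter_filter]
    refine Finset.sum_congr (Finset.filter_congr fun b _ => ?_) fun _ _ => rfl
    have has := (Finset.mem_filter.1 ha).2
    exact ⟨fun hb => ⟨level_eq has ▸ level_anti ψ hst a hb, hb⟩, fun hb => hb.2⟩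
  calc ∑ a ∈ A, q a • (sumOn (level ψ t a) q)⁻¹ • sumOn (level ψ t a) f
      = ∑ a ∈ A, ∑ b ∈ A, if b ∈ level ψ t a then
          (q a * (sumOn (level ψ t a) q)⁻¹) • f b else 0 := by
        refine Finset.sum_congr rfl fun a ha => ?_
        rw [key a ha f hsub, smul_smul, Finset.smul_sum]
        refine Finset.sum_congr rfl fun b _ => ?_
        rw [smul_ite, smul_zero]
    _ = ∑ b ∈ A, ∑ a ∈ A, (if a ∈ level ψ t b then q a else 0) •
          (sumOn (level ψ t b) q)⁻¹ • f b := by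
        rw [Finset.sum_comm]
        refine Finset.sum_congr rfl fun b _ => Finset.sum_congr rfl fun a _ => ?_
        by_cases h : b ∈ level ψ t a
        · rw [if_pos h, if_pos (level_symm h), level_eq h, mul_smul]
        · rw [if_neg h, if_neg (fun h' => h (level_symm h')), zero_smul]
    _ = ∑ b ∈ A, f b := by
        refine Finset.sum_congr rfl fun b hb => ?_
        have hpos : 0 < sumOn (level ψ t b) q := sumOn_pos hq (mem_level_self ψ t b)
          ((hq b).lt_of_ne' (Finsupp.mem_support_iff.1 (Finset.mem_filter.1 hb).1))
        rw [← Finset.sum_smul, ← key b hb q Finset.Subset.rfl, smul_smul,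
          mul_inv_cancel₀ hpos.ne', one_smul]
    _ = sumOn (level ψ s ω) f := (sumOn_apply _ f hsub).symm

lemma IsFlow.exists_isSolution [MeasurableSpace E] [MeasurableSingletonClass E]
    (hVC : ConvexAdapted ψ T V C) (hV : ∀ t ≤ T, ∀ ω, (V t ω).Nonempty) {q : Ω →₀ ℝ}
    {ζ : ℕ → Ω →₀ (Fin d → ℝ)} (h : IsFlow ψ T V C 0 q ζ) (h1 : sumOn univ q = 1) :
    ∃ (ξ : ℕ → Ω → (Fin d → ℝ)) (Q : FinProb Ω), Q.supp = q.support ∧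
      IsSolution ψ T V C ξ Q := by
  classical
  have hsum : ∑ ω ∈ q.support, q ω = 1 := by
    rw [← h1, sumOn_apply univ q Finset.Subset.rfl]
    simp
  have hpos : ∀ ω ∈ q.support, 0 < q ω := fun ω hω =>
    (h.nonneg ω).lt_of_ne' (Finsupp.mem_support_iff.1 hω)
  refine ⟨flowValue ψ V q ζ, ⟨q.support, q, hpos, fun ω hω => by simpa using hω, hsum⟩, rfl,
    ?_, ?_⟩
  · refine fun t ht => ⟨measurable_filt_of_level_const fun ω ω' hω => ?_, fun ω => ?_⟩
    · simp only [flowValue, level_eq hω, hVC.level_left t ht ω ω' hω]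
    · rw [flowValue]
      split_ifs with h0 hne
      · rw [← mem_smul_set_iff_inv_smul_mem₀ h0.ne']
        exact h.value t (Nat.zero_le _) ht ω
      · exact hne.some_mem
      · exact absurd (hV t ht ω) hne
  · intro t ht ω hω
    have hpt : 0 < sumOn (level ψ t ω) q :=
      sumOn_pos h.nonneg (mem_level_self ψ t ω) (hpos ω hω)
    have hcond : condExp ψ t ⟨q.support, q, hpos, fun ω hω => by simpa using hω, hsum⟩
        (flowValue ψ V q ζ (t + 1)) ω
          = (sumOn (level ψ t ω) q)⁻¹ • sumOn (level ψ t ω) (ζ (t + 1)) := by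
      rw [← sum_smul_average (ψ := ψ) h.nonneg (h.support (t + 1) (Nat.zero_le _) ht)
        (Nat.le_succ t) ω, sumOn_apply (level ψ t ω) q Finset.Subset.rfl, condExp, FinProb.meas]
      congr 1
      refine Finset.sum_congr (by congr!) fun ω' hω' => ?_
      have hω'' := (Finset.mem_filter.1 hω').1
      rw [flowValue, if_pos (sumOn_pos h.nonneg (mem_level_self ψ _ ω') (hpos ω' hω''))]
    rw [hcond, flowValue, if_pos hpt, ← smul_sub, ← mem_smul_set_iff_inv_smul_mem₀ hpt.ne']
    exact h.drift t (Nat.zero_le _) ht ω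

end Gluing

/-- Theorem 4.6 (main theorem): the MSP `(V, C)` is solvable iff `W_t(ω) ≠ ∅`
for all `t ∈ I` and `ω ∈ Ω`. -/
theorem msp_solvable_iff_W_nonempty
    {Ω E : Type*}
    [TopologicalSpace Ω] [PolishSpace Ω] [MeasurableSpace Ω] [BorelSpace Ω]
    [MetricSpace E] [TopologicalSpace.SeparableSpace E] [MeasurableSpace E] [BorelSpace E]
    (ψ : ℕ → Ω → E) (hψ : ∀ t, Measurable (ψ t)) (hψ0 : ∃ e : E, ∀ ω, ψ 0 ω = e)
    (d T : ℕ) (V C : ℕ → Ω → Set (Fin d → ℝ)) (hMSP : IsMSP ψ T V C) :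
    Solvable ψ T V C ↔ ∀ t ≤ T, ∀ ω : Ω, (W ψ T V C t ω).Nonempty := by
  have hVC := hMSP.convexAdapted
  constructor
  · intro hsol t ht ω
    have hne : ∀ ω' ∈ level ψ (T - (T - t)) ω, (chargingSet ψ T V C (T - t) ω').Nonempty := by
      intro ω' _
      obtain ⟨ξ, Q, hQ, h⟩ := hsol ω'
      exact ⟨_, h.mem_chargingSet (Nat.sub_le T t) hQ⟩
    exact (hVC.exists_common (T - t) ω hne).mono (hVC.iInter_chargingSet_subset_Wrev (T - t) ω)
  · intro hW ω
    have hrev : ∀ k ≤ T, ∀ ω', (Wrev ψ T V C k ω').Nonempty := by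
      intro k hk ω'
      have := hW (T - k) (Nat.sub_le _ _) ω'
      rwa [W, Nat.sub_sub_self hk] at this
    have hV : ∀ t ≤ T, ∀ ω', (V t ω').Nonempty := by
      intro t ht ω'
      rcases ht.eq_or_lt with rfl | ht
      · exact hrev 0 (Nat.zero_le _) ω'
      · obtain ⟨x, hx, -⟩ := hrev (T - t - 1 + 1) (by omega) ω'
        rw [show T - (T - t - 1 + 1) = t by omega] at hx
        exact ⟨x, hx⟩
    have hC : ∀ t, t + 1 ≤ T → ∀ ω', (C t ω').Nonempty := by
      intro t ht ω'
      obtain ⟨x, -, -, -, c, hc, -⟩ := hrev (T - t - 1 + 1) (by omega) ω'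
      rw [show T - (T - t - 1 + 1) = t by omega] at hc
      exact ⟨c, hc⟩
    obtain ⟨x, hx⟩ := hrev T le_rfl ω
    have hflow := (hVC.subset_flowSet hV hC le_rfl ω).2 (Wrev_subset_chargingSet T ω hx)
    rw [Nat.sub_self] at hflow
    obtain ⟨q, ζ, h, -, hq, h1, -⟩ := hflow
    obtain ⟨ξ, Q, hQ, hs⟩ := h.exists_isSolution hVC hV h1
    exact ⟨ξ, Q, hQ ▸ Finsupp.mem_support_iff.2 (hq ω rfl).ne', hs⟩

end MSPPaper
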